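/- arXiv:2603.15233 — 3 statements merged into one kernel-verified Lean document; each statement's English description precedes it below -/
import Mathlib

section
/- For all integers n ≥ 1, g ≥ 2 and every tuple d = (d_1,…,d_n) with all d_j ≥ 2 and d_1+⋯+d_n = 3g−3+n, one has Σ_{a,b≥0, a+b=d_1−2} Σ_{I⊔J={2,…,n}, X(a,d_I)∈Z, X(b,d_J)∈Z} (X(a,d_I)−1)!·(X(b,d_J)−1)!/(6·(X(d)−1)!) ≤ 2/((X(d)−1)·(X(d)−2)), where the inner sum is over ordered pairs of disjoint subsets I, J of {2,…,n} with I ∪ J = {2,…,n} such that both X(a,d_I) and X(b,d_J) are integers, and d_I denotes the subtuple of d indexed by I. -/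
open scoped BigOperators

noncomputable section

namespace WittenAsym

/-- `g(d)` as a rational number: `g(d) = 1 + (∑ⱼ dⱼ − n)/3`. -/
def gQ (l : List ℕ) : ℚ := 1 + ((l.sum : ℚ) - (l.length : ℚ)) / 3

/-- `X(d)` as a rational number: `X(d) = (∑ⱼ (2dⱼ+1))/3 = 2g(d) − 2 + n`. -/
def XQ (l : List ℕ) : ℚ := (2 * (l.sum : ℚ) + (l.length : ℚ)) / 3

/-- `X(d)` as a natural number (the correct value whenever `X(d)` is an integer). -/
def XN (l : List ℕ) : ℕ := (2 * l.sum + l.length) / 3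

/-- `g(d)` is a nonnegative integer. -/
def IntegralG (l : List ℕ) : Prop := ∃ g : ℕ, (g : ℚ) = gQ l

/-- The subtuple of `r` indexed by the finite index set `I`. -/
def select (r : List ℕ) (I : Finset (Fin r.length)) : List ℕ :=
  ((List.finRange r.length).filter (fun i => i ∈ I)).map r.get

/-- The characterization of the normalized Witten intersection numbers
`C(d) = 2^{2g(d)} ∏ⱼ (2dⱼ+1)!! / (3^{2g(d)-2+n} (2g(d)-3+n)!) ∫ ψ₁^{d₁}⋯ψₙ^{dₙ}`:
they form the unique family of rationals, symmetric in the entries of `d`, vanishing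
when `g(d)` is not a nonnegative integer, with `C(0,0,0) = 1/3`, `C(1) = 1/6`,
and satisfying the DVV recursion whenever `X(d) = 2g(d) - 2 + n ≥ 2`. -/
structure IsNormalizedWitten (C : List ℕ → ℚ) : Prop where
  symm : ∀ {l l' : List ℕ}, l.Perm l' → C l = C l'
  init3 : C [0, 0, 0] = 1/3
  init1 : C [1] = 1/6
  vanish : ∀ l : List ℕ, ¬ IntegralG l → C l = 0
  dvv : ∀ (d₁ : ℕ) (r : List ℕ), IntegralG (d₁ :: r) → 2 ≤ XQ (d₁ :: r) →
    C (d₁ :: r) =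
      (∑ j : Fin r.length,
        if 1 ≤ d₁ + r.get j then
          (2 * (r.get j : ℚ) + 1) / (3 * (XQ (d₁ :: r) - 1)) *
            C (r.set j.val (d₁ + r.get j - 1))
        else 0)
      + ∑ a ∈ Finset.range (d₁ - 1),
          (2 / (3 * (XQ (d₁ :: r) - 1)) * C (a :: (d₁ - 2 - a) :: r)
          + ∑ I : Finset (Fin r.length),
              if 3 ∣ (2 * (a + (select r I).sum) + (1 + (select r I).length)) then
                ((XN (a :: select r I) - 1).factorial : ℚ) *
                  ((XN ((d₁ - 2 - a) :: select r Iᶜ) - 1).factorial : ℚ) /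
                  (6 * ((XN (d₁ :: r) - 1).factorial : ℚ)) *
                  C (a :: select r I) * C ((d₁ - 2 - a) :: select r Iᶜ)
              else 0)

theorem aux_select_toFinset (r : List ℕ) (I : Finset (Fin r.length)) :
    ((List.finRange r.length).filter (fun i => i ∈ I)).toFinset = I := by
  ext i; simp

theorem aux_select_nodup (r : List ℕ) (I : Finset (Fin r.length)) :
    ((List.finRange r.length).filter (fun i => i ∈ I)).Nodup :=
  (List.nodup_finRange _).filter _

theorem aux_select_sum (r : List ℕ) (I : Finset (Fin r.length)) :
    (select r I).sum = ∑ i ∈ I, r.get i := by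
  unfold select
  rw [← List.sum_toFinset _ (aux_select_nodup r I), aux_select_toFinset]

theorem aux_select_length (r : List ℕ) (I : Finset (Fin r.length)) :
    (select r I).length = I.card := by
  unfold select
  rw [List.length_map, ← List.toFinset_card_of_nodup (aux_select_nodup r I),
    aux_select_toFinset]

theorem aux_choose (n : ℕ) : ∀ k, 2 ≤ k → k + 2 ≤ n → n * (n - 1) ≤ 2 * n.choose k := by
  induction n with
  | zero => intro k h1 h2; omega
  | succ n ih =>
    intro k h1 h2
    have two : (n + 1) * (n + 1 - 1) ≤ 2 * (n + 1).choose 2 := by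
      rw [Nat.choose_two_right]
      have := Nat.div_mul_cancel (Nat.even_mul_pred_self (n + 1)).two_dvd
      omega
    by_cases hk : k = 2
    · subst hk; exact two
    by_cases hk' : k + 2 = n + 1
    · have : (n + 1).choose k = (n + 1).choose 2 :=
        Nat.choose_symm_of_eq_add (by omega)
      rw [this]; exact two
    obtain ⟨k, rfl⟩ : ∃ q, k = q + 1 := ⟨k - 1, by omega⟩
    rw [Nat.choose_succ_succ]
    have e1 := ih k (by omega) (by omega)
    have e2 := ih (k + 1) (by omega) (by omega)
    obtain ⟨q, rfl⟩ : ∃ q, n = q + 4 := ⟨n - 4, by omega⟩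
    simp only [Nat.succ_eq_add_one, Nat.add_sub_cancel] at *
    have e3 : q + 4 - 1 = q + 3 := by omega
    rw [e3] at e1 e2
    nlinarith

theorem aux_vand (a b c d : ℕ) :
    (a + b).choose a * (c + d).choose c ≤ (a + b + (c + d)).choose (a + c) := by
  rw [Nat.add_choose_eq (a + b) (c + d) (a + c)]
  exact Finset.single_le_sum (f := fun ij : ℕ × ℕ => (a + b).choose ij.1 * (c + d).choose ij.2)
    (fun _ _ => Nat.zero_le _) (a := (a, c)) (by simp)

/-- One term, bounded through Vandermonde. -/
theorem aux_term (j l t u : ℕ) :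
    ((j + 2 * t).factorial : ℚ) * ((l + 2 * u).factorial : ℚ) /
      (6 * ((j + l + 2 * (t + u) + 2).factorial : ℚ)) ≤
    1 / (6 * ((j + l + 2 * (t + u) + 2 : ℕ) : ℚ) * ((j + l + 2 * (t + u) + 1 : ℕ) : ℚ)) *
      (1 / ((j + l).choose j : ℚ) * (1 / ((2 * (t + u)).choose (2 * t) : ℚ))) := by
  have hv := aux_vand j l (2 * t) (2 * u)
  have hf := Nat.add_choose_mul_factorial_mul_factorial (j + 2 * t) (l + 2 * u)
  have e1 : j + l + (2 * t + 2 * u) = j + l + 2 * (t + u) := by ring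
  have e2 : j + 2 * t + (l + 2 * u) = j + l + 2 * (t + u) := by ring
  have e3 : 2 * t + 2 * u = 2 * (t + u) := by ring
  rw [e1, e3] at hv
  rw [e2] at hf
  have p1 : 0 < (j + l).choose j := Nat.choose_pos (by omega)
  have p2 : 0 < (2 * (t + u)).choose (2 * t) := Nat.choose_pos (by omega)
  generalize (j + l).choose j = A at *
  generalize (2 * (t + u)).choose (2 * t) = B at *
  generalize j + l + 2 * (t + u) = M at *
  rw [Nat.factorial_succ, Nat.factorial_succ]
  have p3 : 0 < M.factorial := Nat.factorial_pos _
  have key : (j + 2 * t).factorial * (l + 2 * u).factorial * (A * B) ≤ M.factorial := by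
    rw [← hf]
    calc _ ≤ (j + 2 * t).factorial * (l + 2 * u).factorial * (M.choose (j + 2 * t)) :=
          Nat.mul_le_mul_left _ hv
      _ = _ := by
          rw [Nat.choose_symm_of_eq_add (show M = (j + 2 * t) + (l + 2 * u) by omega)]
          ring
  have keyQ : ((j + 2 * t).factorial : ℚ) * (l + 2 * u).factorial * (A * B) ≤ M.factorial := by
    exact_mod_cast key
  have q1 : (0 : ℚ) < A := by exact_mod_cast p1
  have q2 : (0 : ℚ) < B := by exact_mod_cast p2
  have q3 : (0 : ℚ) < M.factorial := by exact_mod_cast p3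
  generalize ((j + 2 * t).factorial : ℚ) = F at *
  generalize ((l + 2 * u).factorial : ℚ) = G at *
  have h5 : F * G ≤ M.factorial / (A * B) := by
    rw [le_div_iff₀ (by positivity)]; exact keyQ
  calc F * G / (6 * (((M + 1 + 1) * ((M + 1) * M.factorial) : ℕ) : ℚ))
      ≤ (M.factorial / (A * B)) / (6 * (((M + 1 + 1) * ((M + 1) * M.factorial) : ℕ) : ℚ)) := by
        gcongr
    _ = _ := by
        push_cast
        field_simp
        ring

/-- Number of admissible cardinalities. -/
def auxP (N T t j : ℕ) : Prop := j ≤ 3 * t + 1 ∧ N ≤ 3 * (T - t) + 1 + j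

instance (N T t j : ℕ) : Decidable (auxP N T t j) := by unfold auxP; infer_instance

def auxCnt (N T t : ℕ) : ℕ := ((Finset.range (N + 1)).filter (auxP N T t)).card

theorem aux_cnt_le (N T t : ℕ) : auxCnt N T t ≤ 3 * t + 2 := by
  unfold auxCnt
  calc _ ≤ (Finset.range (3 * t + 2)).card := by
        apply Finset.card_le_card
        intro j; simp [auxP]; omega
    _ = _ := by simp

theorem aux_cnt_top (N T : ℕ) : auxCnt N T T ≤ 2 := by
  unfold auxCnt
  calc _ ≤ (Finset.Icc (N - 1) N).card := by
        apply Finset.card_le_card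
        intro j; simp [auxP]; omega
    _ ≤ 2 := by simp; omega

theorem aux_final (N T : ℕ) :
    ∑ t ∈ Finset.range (T + 1), (auxCnt N T t : ℚ) * (1 / ((2 * T).choose (2 * t) : ℚ)) ≤ 12 := by
  have hb : ∀ t ∈ Finset.range (T + 1),
      (auxCnt N T t : ℚ) * (1 / ((2 * T).choose (2 * t) : ℚ)) ≤
      (if t = 0 then 2 else 0) + (if t = T then 2 else 0) + 4 / ((T : ℚ) + 1) := by
    intro t ht
    have ht' : t ≤ T := by simpa [Nat.lt_succ_iff] using ht
    have hp : (0 : ℚ) ≤ 4 / ((T : ℚ) + 1) := by positivity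
    by_cases h0 : t = 0
    · subst h0
      have h := aux_cnt_le N T 0
      have h' : (auxCnt N T 0 : ℚ) ≤ 2 := by exact_mod_cast h
      simp only [if_true, Nat.mul_zero, Nat.choose_zero_right]
      split_ifs <;> norm_num <;> linarith
    by_cases h1 : t = T
    · subst h1
      have h := aux_cnt_top N t
      have h' : (auxCnt N t t : ℚ) ≤ 2 := by exact_mod_cast h
      simp only [if_true, Nat.choose_self, if_neg h0]
      norm_num; linarith
    rw [if_neg h0, if_neg h1]
    have hc := aux_choose (2 * T) (2 * t) (by omega) (by omega)
    have h := aux_cnt_le N T t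
    obtain ⟨q, rfl⟩ : ∃ q, T = t + 1 + q := ⟨T - t - 1, by omega⟩
    have hpos : 0 < (2 * (t + 1 + q)).choose (2 * t) := Nat.choose_pos (by omega)
    generalize (2 * (t + 1 + q)).choose (2 * t) = C at *
    have e : 2 * (t + 1 + q) - 1 = 2 * t + 2 * q + 1 := by omega
    rw [e] at hc
    have hm : auxCnt N (t + 1 + q) t * (t + 1 + q + 1) ≤ 4 * C := by
      have : 1 ≤ t := by omega
      calc _ ≤ (3 * t + 2) * (t + 1 + q + 1) := Nat.mul_le_mul_right _ h
        _ ≤ 4 * C := by nlinarith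
    have hm' : (auxCnt N (t + 1 + q) t : ℚ) * (((t + 1 + q : ℕ) : ℚ) + 1) ≤ 4 * C := by
      exact_mod_cast hm
    have hC : (0 : ℚ) < C := by exact_mod_cast hpos
    rw [mul_one_div, zero_add, zero_add, div_le_div_iff₀ hC (by positivity)]
    exact hm'
  refine (Finset.sum_le_sum hb).trans ?_
  rw [Finset.sum_add_distrib, Finset.sum_add_distrib, Finset.sum_ite_eq', Finset.sum_ite_eq',
    Finset.sum_const, Finset.card_range, nsmul_eq_mul]
  have : ((T + 1 : ℕ) : ℚ) * (4 / ((T : ℚ) + 1)) = 4 := by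
    push_cast; field_simp
  rw [this]
  split_ifs <;> norm_num

theorem aux_sumI (N T t : ℕ) :
    ∑ I : Finset (Fin N), (if auxP N T t I.card then
        (1 / (N.choose I.card : ℚ) * (1 / ((2 * T).choose (2 * t) : ℚ))) else 0) =
      (auxCnt N T t : ℚ) * (1 / ((2 * T).choose (2 * t) : ℚ)) := by
  have h := Finset.sum_powerset_apply_card (x := (Finset.univ : Finset (Fin N))) (fun j => if auxP N T t j then
        (1 / (N.choose j : ℚ) * (1 / ((2 * T).choose (2 * t) : ℚ))) else 0)
  rw [Finset.powerset_univ, Finset.card_univ, Fintype.card_fin] at h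
  rw [h]
  unfold auxCnt
  rw [Finset.card_filter, Nat.cast_sum, Finset.sum_mul]
  apply Finset.sum_congr rfl
  intro j hj
  have hj' : j ≤ N := by simpa [Nat.lt_succ_iff] using hj
  have : (N.choose j : ℚ) ≠ 0 := by exact_mod_cast (Nat.choose_pos hj').ne'
  split_ifs
  · rw [nsmul_eq_mul]; field_simp; simp
  · simp

/-- The key combinatorial estimate (Lemma on the quadratic term of the DVV recursion):
for `n ≥ 1`, `g ≥ 2` and `d = (d₁,…,dₙ) ∈ (ℤ_{≥2})^n` with `|d| = 3g−3+n`,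
`Σ_{a+b=d₁−2} Σ_{I⊔J={2,…,n}, X(a,d_I),X(b,d_J)∈ℤ}
  (X(a,d_I)−1)!(X(b,d_J)−1)!/(6(X(d)−1)!) ≤ 2/((X(d)−1)(X(d)−2))`. -/
theorem quadratic_term_estimate :
    ∀ g : ℕ, 2 ≤ g → ∀ (d₁ : ℕ) (r : List ℕ), 2 ≤ d₁ → (∀ x ∈ r, 2 ≤ x) →
      d₁ + r.sum = 3 * g - 3 + (r.length + 1) →
      (∑ a ∈ Finset.range (d₁ - 1), ∑ I : Finset (Fin r.length),
          if 3 ∣ (2 * (a + (select r I).sum) + (1 + (select r I).length)) ∧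
              3 ∣ (2 * ((d₁ - 2 - a) + (select r Iᶜ).sum) + (1 + (select r Iᶜ).length)) then
            ((XN (a :: select r I) - 1).factorial : ℚ) *
              ((XN ((d₁ - 2 - a) :: select r Iᶜ) - 1).factorial : ℚ) /
              (6 * ((XN (d₁ :: r) - 1).factorial : ℚ))
          else 0)
        ≤ 2 / (((XN (d₁ :: r) : ℚ) - 1) * ((XN (d₁ :: r) : ℚ) - 2)) := by
  intro g hg d₁ r hd hr hsum
  obtain ⟨T, rfl⟩ : ∃ T, g = T + 2 := ⟨g - 2, by omega⟩
  set N := r.length with hN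
  have hrs : r.sum = ∑ i : Fin r.length, r.get i := by
    simp [Fin.sum_univ_getElem]
  have hX : XN (d₁ :: r) = N + 2 * T + 3 := by
    unfold XN
    simp only [List.sum_cons, List.length_cons]
    omega
  set K : ℚ := 1 / (6 * ((N + 2 * T + 2 : ℕ) : ℚ) * ((N + 2 * T + 1 : ℕ) : ℚ)) with hK
  have hK0 : 0 ≤ K := by positivity
  have hR : (2 : ℚ) / (((XN (d₁ :: r) : ℚ) - 1) * ((XN (d₁ :: r) : ℚ) - 2)) = K * 12 := by
    rw [hX, hK]; push_cast
    have e1 : (N : ℚ) + 2 * T + 3 - 1 = N + 2 * T + 2 := by ring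
    have e2 : (N : ℚ) + 2 * T + 3 - 2 = N + 2 * T + 1 := by ring
    rw [e1, e2]
    field_simp
    norm_num
  rw [hR]
  let c : Finset (Fin r.length) → ℕ → ℚ := fun I t =>
    if auxP N T t I.card then
        (1 / (N.choose I.card : ℚ) * (1 / ((2 * T).choose (2 * t) : ℚ))) else 0
  have hc0 : ∀ I t, 0 ≤ c I t := by
    intro I t
    simp only [c]
    split_ifs
    · positivity
    · exact le_rfl
  have hterm : ∀ a ∈ Finset.range (d₁ - 1), ∀ I : Finset (Fin r.length),
      (if 3 ∣ (2 * (a + (select r I).sum) + (1 + (select r I).length)) ∧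
              3 ∣ (2 * ((d₁ - 2 - a) + (select r Iᶜ).sum) + (1 + (select r Iᶜ).length)) then
            ((XN (a :: select r I) - 1).factorial : ℚ) *
              ((XN ((d₁ - 2 - a) :: select r Iᶜ) - 1).factorial : ℚ) /
              (6 * ((XN (d₁ :: r) - 1).factorial : ℚ))
          else 0) ≤
      ∑ t ∈ Finset.range (T + 1),
        if a + (select r I).sum = I.card + 3 * t + 1 then K * c I t else 0 := by
    intro a ha I
    have ha' : a < d₁ - 1 := by simpa using ha
    have hnn : ∀ t ∈ Finset.range (T + 1), (0 : ℚ) ≤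
        if a + (select r I).sum = I.card + 3 * t + 1 then K * c I t else 0 := by
      intro t _
      split_ifs
      · exact mul_nonneg hK0 (hc0 I t)
      · exact le_rfl
    split_ifs with h
    · obtain ⟨h1, h2⟩ := h
      have hAB : (select r I).sum + (select r Iᶜ).sum = r.sum := by
        rw [aux_select_sum, aux_select_sum, hrs]
        exact Finset.sum_add_sum_compl I _
      have hlow : ∀ J : Finset (Fin r.length), 2 * J.card ≤ (select r J).sum := by
        intro J
        rw [aux_select_sum, mul_comm, ← smul_eq_mul]
        exact Finset.card_nsmul_le_sum _ _ _ (fun i _ => hr _ (List.get_mem r i))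
      have hA := hlow I
      have hB := hlow Iᶜ
      have hcard : I.card + Iᶜ.card = N := by
        rw [Finset.card_add_card_compl, Fintype.card_fin]
      simp only [XN, List.sum_cons, List.length_cons, aux_select_length] at *
      generalize (select r I).sum = A at *
      generalize (select r Iᶜ).sum = B at *
      generalize hj : I.card = j at *
      generalize Iᶜ.card = l at *
      obtain ⟨t, ht⟩ : ∃ t, a + A = j + 3 * t + 1 := ⟨(a + A - j - 1) / 3, by omega⟩
      obtain ⟨u, hu⟩ : ∃ u, (d₁ - 2 - a) + B = l + 3 * u + 1 :=
        ⟨((d₁ - 2 - a) + B - l - 1) / 3, by omega⟩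
      have hT : T = t + u := by omega
      refine le_trans ?_ (Finset.single_le_sum hnn (a := t) (by simp; omega))
      rw [if_pos ht]
      have e1 : (2 * (a + A) + (j + 1)) / 3 - 1 = j + 2 * t := by omega
      have e2 : (2 * (d₁ - 2 - a + B) + (l + 1)) / 3 - 1 = l + 2 * u := by omega
      have hP : auxP N T t I.card := by
        unfold auxP; rw [hj]; omega
      have e3 : (2 * (d₁ + r.sum) + (N + 1)) / 3 - 1 = j + l + 2 * (t + u) + 2 := by omega
      simp only [c]
      rw [if_pos hP, hK, hj, e1, e2, e3, hT, ← hcard]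
      exact aux_term j l t u
    · exact Finset.sum_nonneg hnn
  calc _ ≤ ∑ a ∈ Finset.range (d₁ - 1), ∑ I : Finset (Fin r.length),
        ∑ t ∈ Finset.range (T + 1),
        (if a + (select r I).sum = I.card + 3 * t + 1 then K * c I t else 0) :=
        Finset.sum_le_sum fun a ha => Finset.sum_le_sum fun I _ => hterm a ha I
    _ = ∑ I : Finset (Fin r.length), ∑ t ∈ Finset.range (T + 1),
        ∑ a ∈ Finset.range (d₁ - 1),
        (if a + (select r I).sum = I.card + 3 * t + 1 then K * c I t else 0) := by
        rw [Finset.sum_comm]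
        exact Finset.sum_congr rfl fun I _ => Finset.sum_comm
    _ ≤ ∑ I : Finset (Fin r.length), ∑ t ∈ Finset.range (T + 1), K * c I t := by
        refine Finset.sum_le_sum fun I _ => Finset.sum_le_sum fun t _ => ?_
        rw [← Finset.sum_filter, Finset.sum_const, nsmul_eq_mul]
        have h1 : ((Finset.range (d₁ - 1)).filter
            (fun a => a + (select r I).sum = I.card + 3 * t + 1)).card ≤ 1 := by
          rw [Finset.card_le_one]
          intro x hx y hy
          simp only [Finset.mem_filter] at hx hy
          omega
        have h2 : (((Finset.range (d₁ - 1)).filter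
            (fun a => a + (select r I).sum = I.card + 3 * t + 1)).card : ℚ) ≤ 1 := by
          exact_mod_cast h1
        exact mul_le_of_le_one_left (mul_nonneg hK0 (hc0 I t)) h2
    _ = K * ∑ t ∈ Finset.range (T + 1),
          (auxCnt N T t : ℚ) * (1 / ((2 * T).choose (2 * t) : ℚ)) := by
        rw [Finset.sum_comm, Finset.mul_sum]
        refine Finset.sum_congr rfl fun t _ => ?_
        rw [← Finset.mul_sum, ← aux_sumI]
    _ ≤ K * 12 := mul_le_mul_of_nonneg_left (aux_final N T) hK0

end WittenAsym
end
end

section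
/- Let n ≥ 1 and let d = (d_1,…,d_n) be a tuple with all d_j ≥ 1. (i) If g(0,d) is a positive integer, then C(0,d) ≤ ((3X(0,d)−3p_1(d)−1)/(3X(0,d)−3p_1(d)−3)) · θ_{X(0,d)−p_1(d)−1, n−p_1(d)}. (ii) If g(0,0,d) is a positive integer and X(0,0,d) − p_1(d) ≥ 4, then C(0,0,d) ≤ ((3X(0,0,d)−3p_1(d)−2)(3X(0,0,d)−3p_1(d)−7))/((3X(0,0,d)−3p_1(d)−3)(3X(0,0,d)−3p_1(d)−9)) · θ_{X(0,0,d)−p_1(d)−2, n−p_1(d)}. -/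
open scoped BigOperators

noncomputable section

namespace WittenAsym

/-- `θ_{𝒳,m}`: the maximum of `C(e)` over tuples `e ∈ (ℤ_{≥1})^m` with `g(e) ∈ ℤ`
and `X(e) = 𝒳` (a maximum over a finite set, equal to `0` if the set is empty,
by the convention `sSup ∅ = 0` in `ℝ`). -/
noncomputable def theta (C : List ℕ → ℚ) (X m : ℕ) : ℝ :=
  sSup {x : ℝ | ∃ e : List ℕ, e.length = m ∧ (∀ i ∈ e, 1 ≤ i) ∧ IntegralG e ∧
    XQ e = (X : ℚ) ∧ (C e : ℝ) = x}

theorem integralG_iff (l : List ℕ) : IntegralG l ↔ ∃ g : ℕ, 3 * g + l.length = 3 + l.sum := by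
  unfold IntegralG gQ
  refine exists_congr fun g => ?_
  constructor
  · intro h
    have h2 : (3 * g + l.length : ℚ) = 3 + l.sum := by rw [h]; ring
    exact_mod_cast h2
  · intro h
    have h2 : (3 * g + l.length : ℚ) = 3 + l.sum := by exact_mod_cast h
    linarith

theorem XQ_eq_iff (l : List ℕ) (x : ℕ) : XQ l = x ↔ 2 * l.sum + l.length = 3 * x := by
  unfold XQ
  constructor
  · intro h
    have h2 : (2 * l.sum + l.length : ℚ) = 3 * x := by rw [← h]; ring
    exact_mod_cast h2
  · intro h
    have h2 : (2 * l.sum + l.length : ℚ) = 3 * x := by exact_mod_cast h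
    linarith

theorem le_XQ_iff (l : List ℕ) (x : ℕ) : (x : ℚ) ≤ XQ l ↔ 3 * x ≤ 2 * l.sum + l.length := by
  unfold XQ
  rw [le_div_iff₀ (by norm_num)]
  constructor
  · intro h
    have h2 : ((3 * x : ℕ) : ℚ) ≤ ((2 * l.sum + l.length : ℕ) : ℚ) := by
      simp only [Nat.cast_add, Nat.cast_mul, Nat.cast_ofNat]; linarith
    exact_mod_cast h2
  · intro h
    have h2 : ((3 * x : ℕ) : ℚ) ≤ ((2 * l.sum + l.length : ℕ) : ℚ) := by exact_mod_cast h
    simp only [Nat.cast_add, Nat.cast_mul, Nat.cast_ofNat] at h2; linarith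

theorem select_sublist (r : List ℕ) (I : Finset (Fin r.length)) : (select r I).Sublist r := by
  have h : ((List.finRange r.length).map r.get) = r := by simp
  conv_rhs => rw [← h]
  exact List.Sublist.map _ List.filter_sublist

theorem sum_set_nat (l : List ℕ) (i : ℕ) (h : i < l.length) (a : ℕ) :
    (l.set i a).sum + l[i] = l.sum + a := by
  induction l generalizing i with
  | nil => simp at h
  | cons b t ih =>
    cases i with
    | zero => simp; omega
    | succ k =>
      simp at h
      have := ih k h
      simp; omega

theorem nonneg_aux (C : List ℕ → ℚ) (hC : IsNormalizedWitten C) (N : ℕ) :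
    ∀ l : List ℕ, l ≠ [] → 2 * l.sum + l.length < N → 0 ≤ C l := by
  induction N with
  | zero => intro l _ h; omega
  | succ N ih =>
    intro l hl hN
    by_cases hg : IntegralG l
    swap
    · rw [hC.vanish l hg]
    by_cases hX : (2 : ℚ) ≤ XQ l
    · cases l with
      | nil => exact absurd rfl hl
      | cons d r =>
        rw [hC.dvv d r hg hX]
        have hpos : (0 : ℚ) < 3 * (XQ (d :: r) - 1) := by linarith
        simp only [List.sum_cons, List.length_cons] at hN
        refine add_nonneg (Finset.sum_nonneg fun j _ => ?_) (Finset.sum_nonneg fun a ha => ?_)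
        · split_ifs with h
          · refine mul_nonneg (div_nonneg (by positivity) hpos.le) (ih _ ?_ ?_)
            · intro h0
              have := congrArg List.length h0
              have hj := j.2
              simp at this
              simp [this] at hj
            · have := sum_set_nat r j.1 j.2 (d + r.get j - 1)
              simp only [List.get_eq_getElem] at *
              rw [List.length_set]
              omega
          · exact le_rfl
        · rw [Finset.mem_range] at ha
          refine add_nonneg (mul_nonneg (div_nonneg (by positivity) hpos.le) (ih _ (by simp) ?_))
            (Finset.sum_nonneg fun I _ => ?_)
          · simp only [List.sum_cons, List.length_cons]; omega
          · split_ifs with h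
            · have h1 := (select_sublist r I).length_le
              have h2 := (select_sublist r I).sum_le_sum (by simp)
              have h3 := (select_sublist r Iᶜ).length_le
              have h4 := (select_sublist r Iᶜ).sum_le_sum (by simp)
              refine mul_nonneg (mul_nonneg (by positivity) (ih _ (by simp) ?_)) (ih _ (by simp) ?_)
              · simp only [List.sum_cons, List.length_cons]; omega
              · simp only [List.sum_cons, List.length_cons]; omega
            · exact le_rfl
    · have hX' : ¬ (3 * 2 ≤ 2 * l.sum + l.length) := by
        rw [← le_XQ_iff]; exact_mod_cast hX
      obtain ⟨g, hg⟩ := (integralG_iff l).1 hg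
      match l, hl with
      | [a], _ =>
        simp at hX' hg
        have : a = 1 := by omega
        subst this; rw [hC.init1]; norm_num
      | [a, b], _ => simp at hX' hg; omega
      | [a, b, c], _ =>
        simp at hX' hg
        have h1 : a = 0 := by omega
        have h2 : b = 0 := by omega
        have h3 : c = 0 := by omega
        subst h1 h2 h3; rw [hC.init3]; norm_num
      | a :: b :: c :: d :: t, _ => simp at hX' hg; omega

theorem C_nonneg (C : List ℕ → ℚ) (hC : IsNormalizedWitten C) (l : List ℕ) (hl : l ≠ []) :
    0 ≤ C l := nonneg_aux C hC _ l hl (Nat.lt_succ_self _)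

theorem sum_weights (l : List ℕ) :
    (∑ j : Fin l.length, (2 * (l.get j : ℚ) + 1)) = 2 * l.sum + l.length := by
  have h : (∑ j : Fin l.length, l.get j) = l.sum := by
    rw [← List.sum_ofFn]; simp
  rw [Finset.sum_add_distrib, ← Finset.mul_sum, ← h]
  simp

theorem dilaton (C : List ℕ → ℚ) (hC : IsNormalizedWitten C) (l : List ℕ)
    (hX : 3 ≤ 2 * l.sum + l.length) : C (1 :: l) = C l := by
  by_cases hg : IntegralG (1 :: l)
  · have h2 : (2 : ℚ) ≤ XQ (1 :: l) := by
      have := (le_XQ_iff (1 :: l) 2).2 (by simp; omega)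
      exact_mod_cast this
    rw [hC.dvv 1 l hg h2]
    have hne : 3 * (XQ (1 :: l) - 1) ≠ 0 := by
      intro h; linarith
    have hw : 3 * (XQ (1 :: l) - 1) = 2 * l.sum + l.length := by
      unfold XQ; push_cast [List.sum_cons, List.length_cons]; ring
    simp only [Nat.sub_self, Finset.range_zero, Finset.sum_empty, add_zero]
    have : ∀ j : Fin l.length, (if 1 ≤ 1 + l.get j then
          (2 * (l.get j : ℚ) + 1) / (3 * (XQ (1 :: l) - 1)) *
            C (l.set j.val (1 + l.get j - 1)) else 0)
          = (2 * (l.get j : ℚ) + 1) * (C l / (3 * (XQ (1 :: l) - 1))) := by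
      intro j
      rw [if_pos (by omega), Nat.add_sub_cancel_left]
      simp only [List.get_eq_getElem, List.set_getElem_self]
      ring
    rw [Finset.sum_congr rfl (fun j _ => this j), ← Finset.sum_mul, sum_weights, ← hw]
    exact mul_div_cancel₀ _ hne
  · rw [hC.vanish _ hg, hC.vanish]
    rw [integralG_iff] at hg ⊢
    simp only [List.sum_cons, List.length_cons] at hg
    rintro ⟨g, h⟩
    exact hg ⟨g, by omega⟩

theorem dilaton_replicate (C : List ℕ → ℚ) (hC : IsNormalizedWitten C) (l : List ℕ)
    (hX : 3 ≤ 2 * l.sum + l.length) (p : ℕ) : C (List.replicate p 1 ++ l) = C l := by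
  induction p with
  | zero => simp
  | succ p ih =>
    rw [List.replicate_succ, List.cons_append, dilaton C hC _ (by simp; omega), ih]

theorem theta_nonneg (C : List ℕ → ℚ) (hC : IsNormalizedWitten C) (X m : ℕ) (hX : 1 ≤ X) :
    0 ≤ theta C X m := by
  apply Real.sSup_nonneg
  rintro x ⟨e, -, -, -, h, rfl⟩
  rw [XQ_eq_iff] at h
  have : e ≠ [] := by rintro rfl; simp at h; omega
  exact_mod_cast C_nonneg C hC e this

theorem le_theta (C : List ℕ → ℚ) (e : List ℕ) (X m : ℕ) (hm : e.length = m)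
    (h1 : ∀ i ∈ e, 1 ≤ i) (hg : IntegralG e) (hX : 2 * e.sum + e.length = 3 * X) :
    (C e : ℝ) ≤ theta C X m := by
  refine le_csSup ?_ ⟨e, hm, h1, hg, (XQ_eq_iff e X).2 hX, rfl⟩
  apply Set.Finite.bddAbove
  have hfin : Set.Finite {l : List ℕ | l.length = m ∧ ∀ x ∈ l, x < 3 * X + 1} := by
    have : {l : List ℕ | l.length = m ∧ ∀ x ∈ l, x < 3 * X + 1} ⊆
        (fun f : Fin m → Fin (3 * X + 1) => List.ofFn (fun i => (f i : ℕ))) '' Set.univ := by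
      rintro l ⟨rfl, h⟩
      exact ⟨fun i => ⟨l.get i, h _ (List.get_mem l i)⟩, trivial, by simp⟩
    exact (Set.finite_univ.image _).subset this
  refine (hfin.image (fun l => (C l : ℝ))).subset ?_
  rintro x ⟨e', hm', -, -, hX', rfl⟩
  refine ⟨e', ⟨hm', fun x hx => ?_⟩, rfl⟩
  rw [XQ_eq_iff] at hX'
  have := List.single_le_sum (by simp) x hx
  omega

theorem theta_mono (C : List ℕ → ℚ) (hC : IsNormalizedWitten C) (X m : ℕ) (hX : 1 ≤ X) :
    theta C X m ≤ theta C (X + 1) (m + 1) := by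
  refine Real.sSup_le ?_ (theta_nonneg C hC _ _ (by omega))
  rintro x ⟨e, hm, h1, hg, h, rfl⟩
  rw [XQ_eq_iff] at h
  rw [← dilaton C hC e (by omega)]
  refine le_theta C _ _ _ (by simp [hm]) (by simpa using h1) ?_ (by simp; omega)
  rw [integralG_iff] at hg ⊢
  obtain ⟨g, hg⟩ := hg
  exact ⟨g, by simp; omega⟩

theorem string_one (C : List ℕ → ℚ) (hC : IsNormalizedWitten C) (r : List ℕ) (X : ℕ)
    (hr : ∀ x ∈ r, 1 ≤ x) (hg : IntegralG (0 :: r)) (hX : 2 * r.sum + r.length + 1 = 3 * X)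
    (h2 : 2 ≤ X) (B : ℝ)
    (hB : ∀ j : Fin r.length, (C (r.set j.1 (r.get j - 1)) : ℝ) ≤ B) :
    (C (0 :: r) : ℝ) ≤ (3 * X - 1) / (3 * X - 3) * B := by
  have hXQ : XQ (0 :: r) = X := (XQ_eq_iff _ _).2 (by simp; omega)
  have h2q : (2 : ℚ) ≤ X := by exact_mod_cast h2
  have h2r : (2 : ℝ) ≤ X := by exact_mod_cast h2
  rw [hC.dvv 0 r hg (by rw [hXQ]; exact h2q), hXQ]
  simp only [Nat.zero_sub, Finset.range_zero, Finset.sum_empty, add_zero, zero_add]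
  have hw : (∑ j : Fin r.length, (2 * (r.get j : ℝ) + 1)) = 3 * X - 1 := by
    have h := sum_weights r
    have h' : (2 * r.sum + r.length + 1 : ℚ) = 3 * X := by exact_mod_cast hX
    have h3 : (∑ j : Fin r.length, (2 * (r.get j : ℚ) + 1)) = 3 * X - 1 := by rw [h]; linarith
    exact_mod_cast congrArg (fun q : ℚ => (q : ℝ)) h3
  push_cast
  rw [← hw, Finset.sum_div, Finset.sum_mul]
  refine Finset.sum_le_sum fun j _ => ?_
  rw [if_pos (hr _ (List.get_mem r j))]
  push_cast
  have : (3 * ((X : ℝ) - 1)) = 3 * X - 3 := by ring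
  rw [this]
  exact mul_le_mul_of_nonneg_left (hB j) (div_nonneg (by positivity) (by linarith))

theorem string_two (C : List ℕ → ℚ) (hC : IsNormalizedWitten C) (r : List ℕ) (X : ℕ)
    (hr : ∀ x ∈ r, 1 ≤ x) (hg : IntegralG (0 :: 0 :: r))
    (hX : 2 * r.sum + r.length + 2 = 3 * X)
    (h2 : 2 ≤ X) (B : ℝ)
    (hB : ∀ j : Fin r.length, (C (0 :: r.set j.1 (r.get j - 1)) : ℝ) ≤ B) :
    (C (0 :: 0 :: r) : ℝ) ≤ (3 * X - 2) / (3 * X - 3) * B := by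
  have hXQ : XQ (0 :: 0 :: r) = X := (XQ_eq_iff _ _).2 (by simp; omega)
  have h2q : (2 : ℚ) ≤ X := by exact_mod_cast h2
  have h2r : (2 : ℝ) ≤ X := by exact_mod_cast h2
  rw [hC.dvv 0 (0 :: r) hg (by rw [hXQ]; exact h2q), hXQ]
  simp only [Nat.zero_sub, Finset.range_zero, Finset.sum_empty, add_zero, zero_add]
  have hw : (∑ j : Fin r.length, (2 * (r.get j : ℝ) + 1)) = 3 * X - 2 := by
    have h := sum_weights r
    have h' : (2 * r.sum + r.length + 2 : ℚ) = 3 * X := by exact_mod_cast hX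
    have h3 : (∑ j : Fin r.length, (2 * (r.get j : ℚ) + 1)) = 3 * X - 2 := by rw [h]; linarith
    exact_mod_cast congrArg (fun q : ℚ => (q : ℝ)) h3
  have hs := Fin.sum_univ_succ (n := r.length) (fun j : Fin (0 :: r).length =>
    if 1 ≤ (0 :: r).get j then
          (2 * ((0 :: r).get j : ℚ) + 1) / (3 * ((X : ℚ) - 1)) *
            C ((0 :: r).set j.val ((0 :: r).get j - 1)) else 0)
  rw [show (∑ j : Fin (0 :: r).length,
    if 1 ≤ (0 :: r).get j then
          (2 * ((0 :: r).get j : ℚ) + 1) / (3 * ((X : ℚ) - 1)) *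
            C ((0 :: r).set j.val ((0 :: r).get j - 1)) else 0) = _ from hs]
  have h0 : ¬ (1 ≤ (0 :: r).get (0 : Fin (r.length + 1))) := by simp
  rw [if_neg h0, zero_add]
  push_cast
  rw [← hw, Finset.sum_div, Finset.sum_mul]
  refine Finset.sum_le_sum fun j _ => ?_
  rw [if_pos (show 1 ≤ (0 :: r).get j.succ from hr _ (List.get_mem r j))]
  push_cast
  have : (3 * ((X : ℝ) - 1)) = 3 * X - 3 := by ring
  rw [this]
  exact mul_le_mul_of_nonneg_left (hB j) (div_nonneg (by positivity) (by linarith))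

theorem one_zero (C : List ℕ → ℚ) (hC : IsNormalizedWitten C) (r : List ℕ) (X : ℕ)
    (hr : ∀ x ∈ r, 2 ≤ x) (hg : IntegralG (0 :: r)) (hX : 2 * r.sum + r.length + 1 = 3 * X)
    (h2 : 2 ≤ X) :
    (C (0 :: r) : ℝ) ≤ (3 * X - 1) / (3 * X - 3) * theta C (X - 1) r.length := by
  refine string_one C hC r X (fun x hx => le_trans (by norm_num) (hr x hx)) hg hX h2 _ ?_
  intro j
  have hj : 2 ≤ r.get j := hr _ (List.get_mem r j)
  have hs := sum_set_nat r j.1 j.2 (r.get j - 1)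
  simp only [List.get_eq_getElem] at hj hs ⊢
  refine le_theta C _ _ _ (by simp) ?_ ?_ (by rw [List.length_set]; omega)
  · intro i hi
    rcases List.mem_or_eq_of_mem_set hi with h | h
    · exact le_trans (by norm_num) (hr i h)
    · omega
  · rw [integralG_iff] at hg ⊢
    obtain ⟨g, hg⟩ := hg
    simp only [List.sum_cons, List.length_cons] at hg
    exact ⟨g, by rw [List.length_set]; omega⟩

theorem two_zero (C : List ℕ → ℚ) (hC : IsNormalizedWitten C) (r : List ℕ) (X : ℕ)
    (hr : ∀ x ∈ r, 2 ≤ x) (hg : IntegralG (0 :: 0 :: r))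
    (hX : 2 * r.sum + r.length + 2 = 3 * X) (h4 : 4 ≤ X) :
    (C (0 :: 0 :: r) : ℝ) ≤ ((3 * X - 2) * (3 * X - 7)) / ((3 * X - 3) * (3 * X - 9)) *
      theta C (X - 2) r.length := by
  have h4r : (4 : ℝ) ≤ X := by exact_mod_cast h4
  have hth := theta_nonneg C hC (X - 2) r.length (by omega)
  rw [mul_div_mul_comm, mul_assoc]
  refine string_two C hC r X (fun x hx => le_trans (by norm_num) (hr x hx)) hg hX (by omega) _ ?_
  intro j
  have hj : 2 ≤ r.get j := hr _ (List.get_mem r j)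
  have hs := sum_set_nat r j.1 j.2 (r.get j - 1)
  obtain ⟨g, hg⟩ := (integralG_iff _).1 hg
  simp only [List.sum_cons, List.length_cons] at hg
  by_cases h3 : r.get j = 2
  · have hp : (0 :: r.set j.1 (r.get j - 1)).Perm (1 :: 0 :: r.eraseIdx j.1) := by
      rw [h3]
      exact ((List.set_perm_cons_eraseIdx j.2 1).cons 0).trans (List.Perm.swap _ _ _)
    have hsum := hp.sum_eq
    have hlen := hp.length_eq
    simp only [List.sum_cons, List.length_cons, List.length_set, List.get_eq_getElem]
      at hsum hlen h3 hj hs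
    rw [hC.symm hp, dilaton C hC _ (by simp only [List.sum_cons, List.length_cons]; omega)]
    have hb := one_zero C hC (r.eraseIdx j.1) (X - 2)
      (fun x hx => hr x (List.mem_of_mem_eraseIdx hx))
      ((integralG_iff _).2 ⟨g, by simp only [List.sum_cons, List.length_cons]; omega⟩)
      (by omega) (by omega)
    have hm := theta_mono C hC (X - 2 - 1) (r.eraseIdx j.1).length (by omega)
    rw [show X - 2 - 1 + 1 = X - 2 by omega, show (r.eraseIdx j.1).length + 1 = r.length by omega]
      at hm
    refine hb.trans ?_
    rw [Nat.cast_sub (by omega)]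
    push_cast
    rw [show (3 * ((X : ℝ) - 2) - 1) = 3 * X - 7 by ring,
      show (3 * ((X : ℝ) - 2) - 3) = 3 * X - 9 by ring]
    exact mul_le_mul_of_nonneg_left hm (div_nonneg (by linarith) (by linarith))
  · simp only [List.get_eq_getElem] at h3 hj hs ⊢
    have hb := one_zero C hC (r.set j.1 (r[j.1] - 1)) (X - 1)
      (fun x hx => by
        rcases List.mem_or_eq_of_mem_set hx with h | h
        · exact hr x h
        · omega)
      ((integralG_iff _).2 ⟨g, by
        simp only [List.sum_cons, List.length_cons, List.length_set]; omega⟩)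
      (by rw [List.length_set]; omega) (by omega)
    refine hb.trans ?_
    rw [List.length_set, show X - 1 - 1 = X - 2 by omega, Nat.cast_sub (by omega)]
    push_cast
    refine mul_le_mul_of_nonneg_right ?_ hth
    rw [div_le_div_iff₀ (by linarith) (by linarith)]
    nlinarith

theorem perm_ones (l : List ℕ) :
    l.Perm (List.replicate (l.count 1) 1 ++ l.filter (fun x => !(x == 1))) := by
  have h := (List.filter_append_perm (fun x => x == 1) l).symm
  rwa [List.filter_beq] at h

/-- Estimates for one and two zero insertions in terms of `θ`:
(i) `C(0,d) ≤ (3X(0,d)−3p₁(d)−1)/(3X(0,d)−3p₁(d)−3) · θ_{X(0,d)−p₁(d)−1, n−p₁(d)}`;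
(ii) if moreover `X(0,0,d) − p₁(d) ≥ 4`, then
`C(0,0,d) ≤ ((3X−3p₁−2)(3X−3p₁−7))/((3X−3p₁−3)(3X−3p₁−9)) · θ_{X−p₁−2, n−p₁}`
with `X = X(0,0,d)`, `p₁ = p₁(d)`. -/
theorem zero_insertion_estimates (C : List ℕ → ℚ) (hC : IsNormalizedWitten C)
    (l : List ℕ) (hl : l ≠ []) (hl1 : ∀ x ∈ l, 1 ≤ x) :
    ((∃ g : ℕ, 1 ≤ g ∧ (g : ℚ) = gQ (0 :: l)) →
      (C (0 :: l) : ℝ) ≤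
        (3 * (XN (0 :: l) : ℝ) - 3 * (l.count 1 : ℝ) - 1) /
            (3 * (XN (0 :: l) : ℝ) - 3 * (l.count 1 : ℝ) - 3) *
          theta C (XN (0 :: l) - l.count 1 - 1) (l.length - l.count 1)) ∧
    ((∃ g : ℕ, 1 ≤ g ∧ (g : ℚ) = gQ (0 :: 0 :: l)) →
      l.count 1 + 4 ≤ XN (0 :: 0 :: l) →
      (C (0 :: 0 :: l) : ℝ) ≤
        ((3 * (XN (0 :: 0 :: l) : ℝ) - 3 * (l.count 1 : ℝ) - 2) *
            (3 * (XN (0 :: 0 :: l) : ℝ) - 3 * (l.count 1 : ℝ) - 7)) /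
          ((3 * (XN (0 :: 0 :: l) : ℝ) - 3 * (l.count 1 : ℝ) - 3) *
            (3 * (XN (0 :: 0 :: l) : ℝ) - 3 * (l.count 1 : ℝ) - 9)) *
          theta C (XN (0 :: 0 :: l) - l.count 1 - 2) (l.length - l.count 1)) := by
  obtain ⟨r, hrdef⟩ : ∃ r, r = l.filter (fun x => !(x == 1)) := ⟨_, rfl⟩
  have hp := perm_ones l
  rw [← hrdef] at hp
  have hr : ∀ x ∈ r, 2 ≤ x := by
    intro x hx
    rw [hrdef, List.mem_filter] at hx
    have h1 := hl1 x hx.1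
    have h2 : x ≠ 1 := by simpa using hx.2
    omega
  have hsum := hp.sum_eq
  have hlen := hp.length_eq
  obtain ⟨p, hpdef⟩ : ∃ p, p = l.count 1 := ⟨_, rfl⟩
  rw [← hpdef] at hp hsum hlen ⊢
  simp only [List.sum_append, List.length_append, List.sum_replicate, List.length_replicate,
    smul_eq_mul, mul_one] at hsum hlen
  have hnr : l.length - p = r.length := by omega
  rw [hnr]
  constructor
  · rintro ⟨g, -, hg⟩
    obtain ⟨g, hg⟩ := (integralG_iff _).1 ⟨g, hg⟩
    simp only [List.sum_cons, List.length_cons] at hg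
    obtain ⟨X, hX⟩ : ∃ X, 2 * r.sum + r.length + 1 = 3 * X :=
      ⟨(2 * r.sum + r.length + 1) / 3, by omega⟩
    have hne : r ≠ [] := by
      rintro rfl
      simp at hsum hlen
      omega
    have hX2 : 2 ≤ X := by
      obtain ⟨x, t, rfl⟩ := List.exists_cons_of_ne_nil hne
      have := hr x (by simp)
      simp at hX
      omega
    have hXN : XN (0 :: l) = X + p := by
      unfold XN
      simp only [List.sum_cons, List.length_cons]
      omega
    have hCe : C (0 :: l) = C (0 :: r) := by
      rw [hC.symm (((hp.cons 0).trans List.perm_middle.symm)),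
        dilaton_replicate C hC _ (by simp only [List.sum_cons, List.length_cons]; omega)]
    have hb := one_zero C hC r X hr ((integralG_iff _).2 ⟨g, by
      simp only [List.sum_cons, List.length_cons]; omega⟩) hX hX2
    rw [hCe, hXN, show X + p - p - 1 = X - 1 by omega]
    convert hb using 3 <;> push_cast <;> ring
  · rintro ⟨g, -, hg⟩ h4
    obtain ⟨g, hg⟩ := (integralG_iff _).1 ⟨g, hg⟩
    simp only [List.sum_cons, List.length_cons] at hg
    obtain ⟨X, hX⟩ : ∃ X, 2 * r.sum + r.length + 2 = 3 * X :=
      ⟨(2 * r.sum + r.length + 2) / 3, by omega⟩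
    have hXN : XN (0 :: 0 :: l) = X + p := by
      unfold XN
      simp only [List.sum_cons, List.length_cons]
      omega
    have hX4 : 4 ≤ X := by omega
    have hCe : C (0 :: 0 :: l) = C (0 :: 0 :: r) := by
      have h1 : (0 :: 0 :: l).Perm (List.replicate p 1 ++ (0 :: 0 :: r)) :=
        (((hp.cons 0).trans List.perm_middle.symm).cons 0).trans List.perm_middle.symm
      rw [hC.symm h1,
        dilaton_replicate C hC _ (by simp only [List.sum_cons, List.length_cons]; omega)]
    have hb := two_zero C hC r X hr ((integralG_iff _).2 ⟨g, by
      simp only [List.sum_cons, List.length_cons]; omega⟩) hX hX4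
    rw [hCe, hXN, show X + p - p - 2 = X - 2 by omega]
    convert hb using 3 <;> push_cast <;> ring

end WittenAsym
end
end

section
/- Define f(𝒳,n) for integers 𝒳, n ≥ 1 by f(𝒳,n) = 1/π whenever 1 ≤ 𝒳 ≤ 7 or n ∈ {1,2}, and f(𝒳,n) = (2/3)·f(𝒳−1, n−1) + (1/3)·f(𝒳−1, n+1) + 4/((𝒳−1)(𝒳−2)) for n ≥ 3 and 𝒳 ≥ 8. Then (i) 1/π ≤ f(𝒳,n) ≤ 1 for all 𝒳, n ≥ 1, and (ii) f(𝒳,n) ≤ f(𝒳,n+1) for all 𝒳, n ≥ 1, i.e. f is monotone increasing in n. -/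
noncomputable section

namespace WittenAsym

/-- The comparison function `f(𝒳,n)`: `f(𝒳,n) = 1/π` for `𝒳 ≤ 7` or `n ≤ 2`, and
`f(𝒳,n) = (2/3)f(𝒳−1,n−1) + (1/3)f(𝒳−1,n+1) + 4/((𝒳−1)(𝒳−2))` for `n ≥ 3`, `𝒳 ≥ 8`. -/
noncomputable def f (X n : ℕ) : ℝ :=
  if h : X ≤ 7 ∨ n ≤ 2 then 1 / Real.pi
  else (2 / 3) * f (X - 1) (n - 1) + (1 / 3) * f (X - 1) (n + 1) +
    4 / (((X : ℝ) - 1) * ((X : ℝ) - 2))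
termination_by X
decreasing_by all_goals omega

theorem f_base (X n : ℕ) (h : X ≤ 7 ∨ n ≤ 2) : f X n = 1 / Real.pi := by
  rw [f, dif_pos h]

theorem f_step (k n : ℕ) : f (k + 8) (n + 3) =
    (2 / 3) * f (k + 7) (n + 2) + (1 / 3) * f (k + 7) (n + 4) +
      4 / (((k : ℝ) + 7) * ((k : ℝ) + 6)) := by
  rw [f, dif_neg (by omega)]
  have h1 : k + 8 - 1 = k + 7 := by omega
  have h2 : n + 3 - 1 = n + 2 := by omega
  have h3 : n + 3 + 1 = n + 4 := by omega
  have h4 : ((k + 8 : ℕ) : ℝ) - 1 = k + 7 := by push_cast; ring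
  have h5 : ((k + 8 : ℕ) : ℝ) - 2 = k + 6 := by push_cast; ring
  rw [h1, h2, h3, h4, h5]

theorem f_lower (k n : ℕ) : 1 / Real.pi ≤ f (k + 7) n := by
  induction k generalizing n with
  | zero => rw [f_base _ _ (by omega)]
  | succ k ih =>
    rcases Nat.lt_or_ge n 3 with h | h
    · rw [f_base _ _ (by omega)]
    · obtain ⟨m, rfl⟩ := Nat.exists_eq_add_of_le' h
      have e : k + 1 + 7 = k + 8 := by omega
      rw [e, f_step]
      have hp : (0 : ℝ) ≤ 4 / (((k : ℝ) + 7) * ((k : ℝ) + 6)) := by positivity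
      linarith [ih (m + 2), ih (m + 4)]

theorem f_upper (k n : ℕ) : f (k + 7) n ≤ 1 / Real.pi + 2 / 3 - 4 / ((k : ℝ) + 6) := by
  induction k generalizing n with
  | zero => rw [f_base _ _ (by omega)]; norm_num
  | succ k ih =>
    have hk : (4 : ℝ) / (((k : ℝ) + 7) * ((k : ℝ) + 6)) =
        4 / ((k : ℝ) + 6) - 4 / ((k : ℝ) + 7) := by
      field_simp; ring
    have e' : ((k + 1 : ℕ) : ℝ) + 6 = k + 7 := by push_cast; ring
    rw [e']
    have hk7 : (4 : ℝ) / ((k : ℝ) + 7) ≤ 2 / 3 := by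
      rw [div_le_div_iff₀ (by positivity) (by norm_num)]
      have : (0 : ℝ) ≤ k := by positivity
      linarith
    rcases Nat.lt_or_ge n 3 with h | h
    · rw [f_base _ _ (by omega)]; linarith
    · obtain ⟨m, rfl⟩ := Nat.exists_eq_add_of_le' h
      have e : k + 1 + 7 = k + 8 := by omega
      rw [e, f_step, hk]
      linarith [ih (m + 2), ih (m + 4)]

theorem f_mono (k n : ℕ) : f (k + 7) n ≤ f (k + 7) (n + 1) := by
  induction k generalizing n with
  | zero => rw [f_base _ _ (by omega), f_base _ _ (by omega)]
  | succ k ih =>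
    rcases Nat.lt_or_ge n 3 with h | h
    · rw [f_base _ n (by omega)]; exact f_lower _ _
    · obtain ⟨m, rfl⟩ := Nat.exists_eq_add_of_le' h
      have e : k + 1 + 7 = k + 8 := by omega
      have e2 : m + 3 + 1 = (m + 1) + 3 := by omega
      rw [e, e2, f_step, f_step]
      have a := ih (m + 2)
      have b := ih (m + 4)
      have e3 : m + 1 + 2 = m + 2 + 1 := by omega
      have e4 : m + 1 + 4 = m + 4 + 1 := by omega
      rw [e3, e4]
      linarith

/-- Basic properties of `f`: (i) `1/π ≤ f(𝒳,n) ≤ 1` for all `𝒳, n ≥ 1`, and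
(ii) `f(𝒳,n)` is monotone increasing in `n`. -/
theorem f_bounds_and_monotone :
    (∀ X n : ℕ, 1 ≤ X → 1 ≤ n → 1 / Real.pi ≤ f X n ∧ f X n ≤ 1) ∧
    (∀ X n : ℕ, 1 ≤ X → 1 ≤ n → f X n ≤ f X (n + 1)) := by
  have hpi : 1 / Real.pi ≤ 1 / 3 :=
    one_div_le_one_div_of_le (by norm_num) Real.pi_gt_three.le
  refine ⟨fun X n _ _ => ?_, fun X n _ _ => ?_⟩
  · rcases Nat.lt_or_ge X 7 with h | h
    · rw [f_base _ _ (by omega)]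
      exact ⟨le_rfl, by linarith⟩
    · obtain ⟨k, rfl⟩ := Nat.exists_eq_add_of_le' h
      refine ⟨f_lower k n, ?_⟩
      have hp : (0 : ℝ) ≤ 4 / ((k : ℝ) + 6) := by positivity
      linarith [f_upper k n]
  · rcases Nat.lt_or_ge X 7 with h | h
    · rw [f_base _ _ (by omega), f_base _ _ (by omega)]
    · obtain ⟨k, rfl⟩ := Nat.exists_eq_add_of_le' h
      exact f_mono k n

end WittenAsym
end
end
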